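/- Consider the Yang system ẋ = σ(y − x), ẏ = r x − x z, ż = −b z + x y with real parameters σ > 0, b > 0 and r > 0. Assume the quadratic equation in γ, 4 b r σ² (γ + 2σ − b)² + 16 σ b γ (r σ² + b(σ + b)² − 4σ(σ r + σ b − b²)) = 0, has two distinct real roots γ^(II) > γ^(I) with γ^(II) > 0, and assume b(b − σ) < r σ < b(σ + b). Then every solution (x(t), y(t), z(t)) of the system that is bounded on [0, +∞) tends, as t → +∞, to some equilibrium point of the system. -/

import Mathlib

open Filter

section YangSystem

open Set Topology

theorem antitoneOn_Ici_of_eventually_le {f : ℝ → ℝ} {T : ℝ}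
    (hr : ∀ t, T ≤ t → ∀ᶠ s in 𝓝[>] t, f s ≤ f t)
    (hl : ∀ t, T < t → ∀ᶠ s in 𝓝[<] t, f t ≤ f s) : AntitoneOn f (Ici T) := by
  intro a ha c _ hac
  by_contra! hlt
  have hac' : a < c := hac.lt_of_ne (by rintro rfl; exact lt_irrefl _ hlt)
  set S := {t | t ∈ Icc a c ∧ f t ≤ f a} with hS
  have haS : a ∈ S := ⟨⟨le_rfl, hac⟩, le_rfl⟩
  have hbd : BddAbove S := ⟨c, fun t ht => ht.1.2⟩
  have hmS : sSup S ∈ S := by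
    have hm1 : a ≤ sSup S := le_csSup hbd haS
    have hm2 : sSup S ≤ c := csSup_le ⟨a, haS⟩ fun t ht => ht.1.2
    refine ⟨⟨hm1, hm2⟩, ?_⟩
    rcases hm1.eq_or_lt with h | h
    · rw [← h]
    · have h1 := hl _ (lt_of_le_of_lt ha h)
      rw [eventually_iff, mem_nhdsLT_iff_exists_Ioo_subset] at h1
      obtain ⟨l, hlm, hsub⟩ := h1
      obtain ⟨s, hs, hls⟩ := exists_lt_of_lt_csSup ⟨a, haS⟩ hlm
      rcases (le_csSup hbd hs).eq_or_lt with h2 | h2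
      · rw [← h2]; exact hs.2
      · exact (hsub ⟨hls, h2⟩ : f _ ≤ f s).trans hs.2
  have hmc : sSup S < c := hmS.1.2.lt_of_ne (by intro h; rw [h] at hmS; exact not_le.2 hlt hmS.2)
  obtain ⟨s, hs1, hs2⟩ :=
    ((hr _ (ha.trans hmS.1.1)).and (Ioc_mem_nhdsGT hmc)).exists
  exact not_lt.2 (le_csSup hbd ⟨⟨hmS.1.1.trans hs2.1.le, hs2.2⟩, hs1.trans hmS.2⟩) hs2.1

theorem HasDerivAt.eventually_nhdsGT_le {f : ℝ → ℝ} {f' t : ℝ} (h : HasDerivAt f f' t)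
    (hf : f' < 0) : ∀ᶠ s in 𝓝[>] t, f s ≤ f t := by
  have h1 := (hasDerivAt_iff_tendsto_slope.1 h).mono_left
    (nhdsWithin_mono t (fun s (hs : t < s) => hs.ne'))
  filter_upwards [h1.eventually (gt_mem_nhds hf), self_mem_nhdsWithin] with s hs hts
  rw [slope_def_field, div_neg_iff] at hs
  have : t < s := hts
  rcases hs with hs | hs <;> linarith

theorem HasDerivAt.eventually_nhdsLT_le {f : ℝ → ℝ} {f' t : ℝ} (h : HasDerivAt f f' t)
    (hf : f' < 0) : ∀ᶠ s in 𝓝[<] t, f t ≤ f s := by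
  have h1 := (hasDerivAt_iff_tendsto_slope.1 h).mono_left
    (nhdsWithin_mono t (fun s (hs : s < t) => hs.ne))
  filter_upwards [h1.eventually (gt_mem_nhds hf), self_mem_nhdsWithin] with s hs hts
  rw [slope_def_field, div_neg_iff] at hs
  have : s < t := hts
  rcases hs with hs | hs <;> linarith

theorem antitoneOn_Ici_of_hasDerivAt {f f' : ℝ → ℝ} {T : ℝ}
    (hf : ∀ t, T ≤ t → HasDerivAt f (f' t) t) (hf' : ∀ t, T ≤ t → f' t ≤ 0) :
    AntitoneOn f (Ici T) :=
  antitoneOn_of_hasDerivWithinAt_nonpos (convex_Ici T)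
    (fun t ht => (hf t ht).continuousAt.continuousWithinAt)
    (fun t ht => (hf t (interior_subset ht)).hasDerivWithinAt)
    (fun t ht => hf' t (interior_subset ht))

/-- Comparison: a scalar quantity with linear damping and vanishing forcing tends to zero. -/
theorem eventually_lt_of_hasDerivAt_decay {w g : ℝ → ℝ} {b T ε : ℝ} (hb : 0 < b) (hε : 0 < ε)
    (hw : ∀ t, T ≤ t → HasDerivAt w (-b * w t + g t) t) (hg : Tendsto g atTop (𝓝 0)) :
    ∀ᶠ t in atTop, w t < ε := by
  obtain ⟨S, hS⟩ := eventually_atTop.1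
    (hg.eventually (gt_mem_nhds (show (0 : ℝ) < b * (ε / 2) by positivity)))
  set R := max S T
  have hanti : AntitoneOn (fun t => (w t - ε / 2) * Real.exp (b * t)) (Ici R) := by
    refine antitoneOn_Ici_of_hasDerivAt (f' := fun t => (g t - b * (ε / 2)) * Real.exp (b * t))
      (fun t ht => ?_) (fun t ht => ?_)
    · have h1 := (hw t ((le_max_right _ _).trans ht)).sub_const (ε / 2)
      have h2 := ((hasDerivAt_id t).const_mul b).exp
      refine (h1.mul h2).congr_deriv ?_
      simp only [id]
      ring
    · have := hS t ((le_max_left _ _).trans ht)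
      exact mul_nonpos_of_nonpos_of_nonneg (by linarith) (Real.exp_pos _).le
  have hlim : Tendsto (fun t => (w R - ε / 2) * Real.exp (b * R) * Real.exp (-(b * t)))
      atTop (𝓝 0) := by
    have : Tendsto (fun t : ℝ => Real.exp (-(b * t))) atTop (𝓝 0) :=
      Real.tendsto_exp_neg_atTop_nhds_zero.comp (tendsto_id.const_mul_atTop hb)
    simpa using this.const_mul ((w R - ε / 2) * Real.exp (b * R))
  filter_upwards [eventually_ge_atTop R, hlim.eventually (gt_mem_nhds (half_pos hε))] with t ht h1
  have h2 := hanti (mem_Ici.2 le_rfl) ht ht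
  have h3 : w t - ε / 2 = (w t - ε / 2) * Real.exp (b * t) * Real.exp (-(b * t)) := by
    rw [mul_assoc, ← Real.exp_add]; simp
  have h4 := mul_le_mul_of_nonneg_right h2 (Real.exp_pos (-(b * t))).le
  simp only at h4
  linarith

theorem tendsto_zero_of_hasDerivAt_decay {w g : ℝ → ℝ} {b T : ℝ} (hb : 0 < b)
    (hw : ∀ t, T ≤ t → HasDerivAt w (-b * w t + g t) t) (hg : Tendsto g atTop (𝓝 0)) :
    Tendsto w atTop (𝓝 0) := by
  refine tendsto_order.2 ⟨fun a ha => ?_, fun a ha =>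
    eventually_lt_of_hasDerivAt_decay hb ha hw hg⟩
  have := eventually_lt_of_hasDerivAt_decay (w := -w) (g := -g) (T := T) hb (neg_pos.2 ha)
    (fun t ht => (hw t ht).neg.congr_deriv (by simp only [Pi.neg_apply]; ring))
    (by rw [← neg_zero]; exact hg.neg)
  filter_upwards [this] with t ht
  simp only [Pi.neg_apply] at ht
  linarith

theorem tendsto_zero_of_tendsto_of_hasDerivAt_upper {F f f1 : ℝ → ℝ} {T K l ε : ℝ} (hK : 0 < K)
    (hF : ∀ t, T ≤ t → HasDerivAt F (f t) t) (hf : ∀ t, T ≤ t → HasDerivAt f (f1 t) t)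
    (hf1 : ∀ t, T ≤ t → |f1 t| ≤ K) (hl : Tendsto F atTop (𝓝 l)) (hε : 0 < ε) :
    ∀ᶠ t in atTop, f t < ε := by
  set h := ε / K with hh
  have hpos : 0 < h := div_pos hε hK
  have hlim : Tendsto (fun t => F (t + h) - F t) atTop (𝓝 0) := by
    simpa using (hl.comp (tendsto_atTop_add_const_right atTop h tendsto_id)).sub hl
  have hKh : K * h = ε := by rw [hh]; field_simp
  filter_upwards [eventually_ge_atTop T,
    hlim.eventually (gt_mem_nhds (show 0 < ε * h / 2 by positivity))] with t ht h1
  by_contra! hlt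
  have hfa : AntitoneOn (fun s => -f s - K * s) (Ici T) :=
    antitoneOn_Ici_of_hasDerivAt (f' := fun s => -f1 s - K)
      (fun s hs => by simpa using (hf s hs).fun_neg.fun_sub ((hasDerivAt_id s).const_mul K))
      (fun s hs => by linarith [(abs_le.1 (hf1 s hs)).1])
  have hGa : AntitoneOn (fun s => f t * (s - t) - K * (s - t) ^ 2 / 2 - F s) (Ici t) :=
    antitoneOn_Ici_of_hasDerivAt (f' := fun s => f t - K * (s - t) - f s)
      (fun s hs => by
        have a1 := (hasDerivAt_id s).sub_const t
        refine (((a1.const_mul (f t)).sub (((a1.pow 2).const_mul K).div_const 2)).sub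
          (hF s (ht.trans hs))).congr_deriv ?_
        simp only [id]
        ring)
      (fun s hs => by
        have := hfa ht (ht.trans hs) hs
        simp only at this
        linarith)
  have := hGa (mem_Ici.2 le_rfl) (show t ≤ t + h by linarith) (by linarith)
  simp only [sub_self, add_sub_cancel_left] at this
  have h3 : ε * h ≤ f t * h := mul_le_mul_of_nonneg_right hlt hpos.le
  have h4 : K * h ^ 2 = ε * h := by rw [← hKh]; ring
  nlinarith

/-- Barbalat's lemma for a function with bounded derivative. -/
theorem tendsto_zero_of_tendsto_of_hasDerivAt {F f f1 : ℝ → ℝ} {T K l : ℝ}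
    (hF : ∀ t, T ≤ t → HasDerivAt F (f t) t) (hf : ∀ t, T ≤ t → HasDerivAt f (f1 t) t)
    (hf1 : ∀ t, T ≤ t → |f1 t| ≤ K) (hl : Tendsto F atTop (𝓝 l)) :
    Tendsto f atTop (𝓝 0) := by
  have hK : 0 < |K| + 1 := by positivity
  have hK' : ∀ t, T ≤ t → |f1 t| ≤ |K| + 1 := fun t ht => by
    linarith [hf1 t ht, le_abs_self K]
  refine tendsto_order.2 ⟨fun a ha => ?_, fun a ha =>
    tendsto_zero_of_tendsto_of_hasDerivAt_upper hK hF hf hK' hl ha⟩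
  have := tendsto_zero_of_tendsto_of_hasDerivAt_upper (F := -F) (f := -f) (f1 := -f1) hK
    (fun t ht => (hF t ht).neg) (fun t ht => (hf t ht).neg)
    (fun t ht => by simpa using hK' t ht) hl.neg (neg_pos.2 ha)
  filter_upwards [this] with t ht
  simp only [Pi.neg_apply] at ht
  linarith

theorem exists_primitive_on_Ici {f : ℝ → ℝ} (hf : ∀ t, 0 ≤ t → ContinuousAt f t) :
    ∃ E : ℝ → ℝ, ∀ t, 0 ≤ t → HasDerivAt E (f t) t := by
  have hc : Continuous fun s => f (max s 0) := by
    rw [continuous_iff_continuousAt]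
    intro s
    exact ContinuousAt.comp (f := fun s : ℝ => max s 0) (hf _ (le_max_right _ _))
      (by fun_prop)
  refine ⟨fun t => ∫ s in (0 : ℝ)..t, f (max s 0), fun t ht => ?_⟩
  simpa [max_eq_left ht] using (hc.integral_hasStrictDerivAt 0 t).hasDerivAt

theorem AntitoneOn.exists_tendsto_of_le {f : ℝ → ℝ} {T C : ℝ} (hf : AntitoneOn f (Ici T))
    (hC : ∀ t, T ≤ t → C ≤ f t) : ∃ l, Tendsto f atTop (𝓝 l) := by
  have hanti : Antitone fun t => f (max t T) := fun s t hst =>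
    hf (mem_Ici.2 (le_max_right _ _)) (mem_Ici.2 (le_max_right _ _)) (max_le_max_right _ hst)
  refine ⟨_, (tendsto_atTop_ciInf hanti ⟨C, ?_⟩).congr' ?_⟩
  · rintro _ ⟨t, rfl⟩
    exact hC _ (le_max_right _ _)
  · filter_upwards [eventually_ge_atTop T] with t ht
    rw [max_eq_left ht]

/-- LaSalle-type argument: a lower bounded function dissipating at least `κ * p ^ 2` forces
`p` to vanish asymptotically. -/
theorem tendsto_zero_of_antitoneOn_add_energy {V E p p1 : ℝ → ℝ} {T κ K C : ℝ} (hκ : 0 < κ)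
    (hE : ∀ t, T ≤ t → HasDerivAt E (p t ^ 2) t) (hp : ∀ t, T ≤ t → HasDerivAt p (p1 t) t)
    (hK : ∀ t, T ≤ t → |p t| ≤ K) (hK1 : ∀ t, T ≤ t → |p1 t| ≤ K)
    (hV : AntitoneOn (fun t => V t + κ * E t) (Ici T)) (hC : ∀ t, T ≤ t → C ≤ V t) :
    Tendsto p atTop (𝓝 0) := by
  have hEa : AntitoneOn (fun t => -E t) (Ici T) :=
    antitoneOn_Ici_of_hasDerivAt (fun t ht => (hE t ht).fun_neg)
      fun t _ => neg_nonpos.2 (sq_nonneg _)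
  obtain ⟨l, hl⟩ := hEa.exists_tendsto_of_le (C := -((V T + κ * E T - C) / κ)) fun t ht => by
    have := hV (mem_Ici.2 le_rfl) ht ht
    have h2 := hC t ht
    simp only at this
    rw [neg_le_neg_iff, le_div_iff₀ hκ]
    linarith
  have hsq : Tendsto (fun t => -p t ^ 2) atTop (𝓝 0) := by
    refine tendsto_zero_of_tendsto_of_hasDerivAt (T := T) (K := 2 * K * K)
      (f1 := fun t => -(2 * p t * p1 t)) (fun t ht => (hE t ht).fun_neg)
      (fun t ht => (((hp t ht).pow 2).fun_neg).congr_deriv (by norm_num)) (fun t ht => ?_) hl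
    rw [abs_neg, abs_mul, abs_mul, abs_two]
    have h0 := (abs_nonneg _).trans (hK t ht)
    gcongr
    · exact hK t ht
    · exact hK1 t ht
  have habs := hsq.neg.sqrt
  simp only [neg_neg, Real.sqrt_sq_eq_abs, neg_zero, Real.sqrt_zero] at habs
  exact (tendsto_zero_iff_abs_tendsto_zero _).2 habs

/-- A function that is differentiable with nonpositive derivative except at points where it jumps
strictly downwards is antitone. -/
theorem antitoneOn_Ici_of_hasDerivAt_or_jump {L : ℝ → ℝ} {T : ℝ}
    (h : ∀ t, T ≤ t → (∃ L', HasDerivAt L L' t ∧ L' ≤ 0) ∨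
      ((∃ l, l < L t ∧ Tendsto L (𝓝[>] t) (𝓝 l)) ∧ ∃ l, L t < l ∧ Tendsto L (𝓝[<] t) (𝓝 l))) :
    AntitoneOn L (Ici T) := by
  have key : ∀ ε : ℝ, 0 < ε → AntitoneOn (fun t => L t - ε * t) (Ici T) := fun ε hε => by
    have hlin : ∀ t, Tendsto (fun s => ε * s) (𝓝 t) (𝓝 (ε * t)) := fun t =>
      (continuous_const.mul continuous_id).tendsto t
    have hder : ∀ {t L'}, HasDerivAt L L' t → HasDerivAt (fun t => L t - ε * t) (L' - ε) t :=
      fun {t L'} hL => (hL.sub ((hasDerivAt_id t).const_mul ε)).congr_deriv (by simp)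
    refine antitoneOn_Ici_of_eventually_le (fun t ht => ?_) (fun t ht => ?_)
    · rcases h t ht with ⟨L', hL, hL'⟩ | ⟨⟨l, hl, hlim⟩, -⟩
      · exact (hder hL).eventually_nhdsGT_le (by linarith)
      · filter_upwards [(hlim.sub ((hlin t).mono_left nhdsWithin_le_nhds)).eventually
          (gt_mem_nhds (sub_lt_sub_right hl (ε * t)))] with s hs using hs.le
    · rcases h t ht.le with ⟨L', hL, hL'⟩ | ⟨-, l, hl, hlim⟩
      · exact (hder hL).eventually_nhdsLT_le (by linarith)
      · filter_upwards [(hlim.sub ((hlin t).mono_left nhdsWithin_le_nhds)).eventually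
          (lt_mem_nhds (sub_lt_sub_right hl (ε * t)))] with s hs using hs.le
  intro s hs t ht hst
  refine le_of_forall_pos_le_add fun ε hε => ?_
  have hpos : 0 < t - s + 1 := by linarith
  have h1 := key (ε / (t - s + 1)) (by positivity) hs ht hst
  have h2 : ε / (t - s + 1) * (t - s) ≤ ε := by
    rw [div_mul_eq_mul_div, div_le_iff₀ hpos]
    nlinarith
  simp only at h1
  linarith

theorem forall_lt_or_forall_gt_of_ne {f : ℝ → ℝ} {T c : ℝ} (hf : ContinuousOn f (Ici T))
    (hc : ∀ t, T ≤ t → f t ≠ c) : (∀ t, T ≤ t → f t < c) ∨ ∀ t, T ≤ t → c < f t := by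
  by_contra! h
  obtain ⟨⟨t₁, h₁, hc₁⟩, t₂, h₂, hc₂⟩ := h
  obtain ⟨t, ht, he⟩ := isPreconnected_Ici.intermediate_value h₂ h₁ hf ⟨hc₂, hc₁⟩
  exact hc t ht he

theorem exists_tendsto_of_tendsto_cubic {f : ℝ → ℝ} {T s : ℝ} (hs : 0 < s)
    (hf : ContinuousOn f (Ici T))
    (h : Tendsto (fun t => f t * (s ^ 2 - f t ^ 2)) atTop (𝓝 0)) :
    ∃ l, l * (s ^ 2 - l ^ 2) = 0 ∧ Tendsto f atTop (𝓝 l) := by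
  have key : ∀ l C R : ℝ, (∀ t, R ≤ t → |f t - l| ≤ C * |f t * (s ^ 2 - f t ^ 2)|) →
      Tendsto f atTop (𝓝 l) := fun l C R hb => by
    rw [tendsto_iff_norm_sub_tendsto_zero]
    refine squeeze_zero' (.of_forall fun _ => norm_nonneg _)
      (eventually_atTop.2 ⟨R, hb⟩) ?_
    simpa using h.abs.const_mul C
  obtain ⟨S, hS⟩ := eventually_atTop.1 ((abs_zero (α := ℝ) ▸ h.abs).eventually
    (gt_mem_nhds (show (0 : ℝ) < 3 * s ^ 3 / 8 by positivity)))
  set R := max S T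
  have hfR : ContinuousOn f (Ici R) := hf.mono (Ici_subset_Ici.2 (le_max_right _ _))
  have hSR : ∀ t, R ≤ t → |f t * (s ^ 2 - f t ^ 2)| < 3 * s ^ 3 / 8 := fun t ht =>
    hS t ((le_max_left _ _).trans ht)
  have h1 : ∀ t, R ≤ t → f t ≠ s / 2 := fun t ht he => by
    have := (abs_lt.1 (hSR t ht)).2
    rw [he] at this
    linarith
  have h2 : ∀ t, R ≤ t → f t ≠ -(s / 2) := fun t ht he => by
    have := (abs_lt.1 (hSR t ht)).1
    rw [he] at this
    linarith
  rcases forall_lt_or_forall_gt_of_ne hfR h1 with h1 | h1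
  · rcases forall_lt_or_forall_gt_of_ne hfR h2 with h2 | h2
    · refine ⟨-s, by ring, key (-s) (2 / s ^ 2) R fun t ht => ?_⟩
      have e : f t * (s ^ 2 - f t ^ 2) = (-f t * (s - f t)) * -(f t - -s) := by ring
      have h3 : s ^ 2 / 2 ≤ -f t * (s - f t) := by nlinarith [h2 t ht]
      rw [e, abs_mul, abs_neg, abs_of_nonneg (le_trans (by positivity) h3), ← mul_assoc]
      refine le_mul_of_one_le_left (abs_nonneg _) ?_
      rw [div_mul_eq_mul_div, le_div_iff₀ (by positivity)]
      linarith
    · refine ⟨0, by ring, key 0 (4 / (3 * s ^ 2)) R fun t ht => ?_⟩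
      have h3 : 3 * s ^ 2 / 4 ≤ s ^ 2 - f t ^ 2 := by nlinarith [h1 t ht, h2 t ht]
      rw [sub_zero, abs_mul, abs_of_nonneg (le_trans (by positivity) h3), mul_comm |f t|,
        ← mul_assoc]
      refine le_mul_of_one_le_left (abs_nonneg _) ?_
      rw [div_mul_eq_mul_div, le_div_iff₀ (by positivity)]
      linarith
  · refine ⟨s, by ring, key s (2 / s ^ 2) R fun t ht => ?_⟩
    have e : f t * (s ^ 2 - f t ^ 2) = (f t * (s + f t)) * -(f t - s) := by ring
    have h3 : s ^ 2 / 2 ≤ f t * (s + f t) := by nlinarith [h1 t ht]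
    rw [e, abs_mul, abs_neg, abs_of_nonneg (le_trans (by positivity) h3), ← mul_assoc]
    refine le_mul_of_one_le_left (abs_nonneg _) ?_
    rw [div_mul_eq_mul_div, le_div_iff₀ (by positivity)]
    linarith

/-- The part of the Lyapunov function that does not involve the velocity. -/
noncomputable def yangPotential (σ b r X N : ℝ) : ℝ :=
  -σ * r * X ^ 2 / 2 + (σ - b / 2) * N ^ 2 * X ^ 2 / (2 * b) + X ^ 4 / 8 +
    σ * (σ - b / 4) * (X - N) ^ 2 / 2 +
    (σ - b / 4) * b / 6 * (X ^ 3 / N - 3 * N * X + 2 * N ^ 2) +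
    (σ - b / 4) * b / 6 * ((X - N) ^ 2 * (N + 4 * X) / (N + 2 * X)) -
    σ * (σ - b / 4) / b * (r * N ^ 2 / 2 - N ^ 4 / (4 * b)) -
    (σ - b / 2) * N ^ 4 / (4 * b)

theorem yang_dissipation_identity {σ b r X P N : ℝ} (hb : b ≠ 0) (hN : N ≠ 0)
    (hNX : N + 2 * X ≠ 0) :
    P * (-σ * P + X * (σ * r - (X ^ 2 + (2 * σ - b) / b * N ^ 2) / 2)) +
      (σ - b / 4) * ((-σ * P + X * (σ * r - (X ^ 2 + (2 * σ - b) / b * N ^ 2) / 2)) * (X - N) +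
        P * (P - b * (X ^ 2 - N ^ 2) / (2 * N))) +
      ((-σ * r * X + (σ - b / 2) * N ^ 2 * X / b + X ^ 3 / 2 +
        σ * (σ - b / 4) * (X - N) + (σ - b / 4) * b / 6 * (3 * X ^ 2 / N - 3 * N) +
        (σ - b / 4) * b / 6 * (2 * (X - N) * X * (7 * N + 8 * X) / (N + 2 * X) ^ 2)) * P +
       ((σ - b / 2) * N * X ^ 2 / b - σ * (σ - b / 4) * (X - N) +
        (σ - b / 4) * b / 6 * (-X ^ 3 / N ^ 2 - 3 * X + 4 * N) +
        (σ - b / 4) * b / 6 *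
          ((-2 * (X - N) * (N + 4 * X) + (X - N) ^ 2) / (N + 2 * X) -
            (X - N) ^ 2 * (N + 4 * X) / (N + 2 * X) ^ 2) -
        σ * (σ - b / 4) / b * (r * N - N ^ 3 / b) - (σ - b / 2) * N ^ 3 / b) *
         (b * (X ^ 2 - N ^ 2) / (2 * N))) =
    -(b / 4) * P ^ 2 + (σ - b / 4) * b * (X - N) * (X * (7 * N + 8 * X) / (3 * (N + 2 * X) ^ 2)) * P
     - (X - N) ^ 2 * ((σ - b / 4) * ((b * (σ + b) - σ * r) / 2 + b * X / N * (σ / 2 +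
       b * (4 * X ^ 4 + 12 * X ^ 3 * N + 47 * X ^ 2 * N ^ 2 + 42 * X * N ^ 3 + 9 * N ^ 4) /
         (12 * N ^ 2 * (N + 2 * X) ^ 2))) +
       N ^ 2 / (2 * b) * ((σ - b / 4 - b * (X + N) / (2 * N)) ^ 2 + (σ - b / 4) * b / 4)) := by
  obtain ⟨D, hD⟩ : ∃ D, D = N + 2 * X := ⟨_, rfl⟩
  rw [← hD] at hNX ⊢
  obtain rfl : X = (D - N) / 2 := by linarith
  field_simp
  ring

theorem hasDerivAt_yangPotential {σ b r : ℝ} {X N : ℝ → ℝ} {X' N' t : ℝ} (hb : b ≠ 0)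
    (hX : HasDerivAt X X' t) (hN : HasDerivAt N N' t) (h0 : N t ≠ 0) (hNX : N t + 2 * X t ≠ 0) :
    HasDerivAt (fun s => yangPotential σ b r (X s) (N s))
      ((-σ * r * X t + (σ - b / 2) * N t ^ 2 * X t / b + X t ^ 3 / 2 +
        σ * (σ - b / 4) * (X t - N t) + (σ - b / 4) * b / 6 * (3 * X t ^ 2 / N t - 3 * N t) +
        (σ - b / 4) * b / 6 * (2 * (X t - N t) * X t * (7 * N t + 8 * X t) / (N t + 2 * X t) ^ 2)) * X' +
       ((σ - b / 2) * N t * X t ^ 2 / b - σ * (σ - b / 4) * (X t - N t) +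
        (σ - b / 4) * b / 6 * (-X t ^ 3 / N t ^ 2 - 3 * X t + 4 * N t) +
        (σ - b / 4) * b / 6 *
          ((-2 * (X t - N t) * (N t + 4 * X t) + (X t - N t) ^ 2) / (N t + 2 * X t) -
            (X t - N t) ^ 2 * (N t + 4 * X t) / (N t + 2 * X t) ^ 2) -
        σ * (σ - b / 4) / b * (r * N t - N t ^ 3 / b) - (σ - b / 2) * N t ^ 3 / b) * N') t := by
  unfold yangPotential
  have h1 := ((hX.pow 2).const_mul (-σ * r)).div_const 2
  have h2 := (((hN.pow 2).const_mul (σ - b / 2)).mul (hX.pow 2)).div_const (2 * b)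
  have h3 := (hX.pow 4).div_const 8
  have h4 := (((hX.sub hN).pow 2).const_mul (σ * (σ - b / 4))).div_const 2
  have h5 := ((((hX.pow 3).div hN h0).sub ((hN.const_mul 3).mul hX)).add ((hN.pow 2).const_mul 2)).const_mul
    ((σ - b / 4) * b / 6)
  have h6 := ((((hX.sub hN).pow 2).mul (hN.add (hX.const_mul 4))).div (hN.add (hX.const_mul 2)) hNX).const_mul
    ((σ - b / 4) * b / 6)
  have h7 := ((((hN.pow 2).const_mul r).div_const 2).sub ((hN.pow 4).div_const (4 * b))).const_mul
    (σ * (σ - b / 4) / b)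
  have h8 := ((hN.pow 4).const_mul (σ - b / 2)).div_const (4 * b)
  refine ((((((((h1.add h2).add h3).add h4).add h5).add h6).sub h7).sub h8).congr_deriv ?_)
  simp only [Pi.add_apply, Pi.mul_apply, Pi.sub_apply, Pi.pow_apply]
  obtain ⟨D, hD⟩ : ∃ D, D = N t + 2 * X t := ⟨_, rfl⟩
  rw [← hD] at hNX ⊢
  obtain hX : X t = (D - N t) / 2 := by linarith
  rw [hX]
  field_simp
  ring
theorem yang_quartic_pos {X N : ℝ} (hX : 0 ≤ X) (hN : 0 ≤ N) :
    25 * X * N * (7 * N + 8 * X) ^ 2 ≤ 108 * (N + 2 * X) ^ 4 := by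
  nlinarith [mul_nonneg (mul_nonneg hX hX) (sq_nonneg (X - N / 4)),
    mul_nonneg (mul_nonneg hX hN) (sq_nonneg (X - N / 4)),
    mul_nonneg (mul_nonneg hN hN) (sq_nonneg (X - N / 4)), mul_nonneg hX hN,
    pow_nonneg hX 4, pow_nonneg hN 4, mul_nonneg (pow_nonneg hX 3) hN,
    mul_nonneg (pow_nonneg hX 2) (pow_nonneg hN 2), mul_nonneg hX (pow_nonneg hN 3)]

/-- The Lyapunov function on the half-space `X > 0`, in the variables `X = x`, `P = ẋ` and
`N ^ 2 = b * (2 * σ * z - x ^ 2) / (2 * σ - b)`. -/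
noncomputable def yangLyapunov (σ b r X P N : ℝ) : ℝ :=
  P ^ 2 / 2 + (σ - b / 4) * P * (X - N) + yangPotential σ b r X N

theorem yangLyapunov_dissipation {σ b r : ℝ} {X P N : ℝ → ℝ} {t : ℝ} (hb : 0 < b)
    (hbσ : b < 2 * σ) (hr : r * σ < b * (σ + b)) (hX : HasDerivAt X (P t) t)
    (hP : HasDerivAt P
      (-σ * P t + X t * (σ * r - (X t ^ 2 + (2 * σ - b) / b * N t ^ 2) / 2)) t)
    (hN : HasDerivAt N (b * (X t ^ 2 - N t ^ 2) / (2 * N t)) t) (hX0 : 0 < X t) (hN0 : 0 < N t) :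
    ∃ V', HasDerivAt (fun s => yangLyapunov σ b r (X s) (P s) (N s)) V' t ∧
      V' ≤ -(b / 100 * P t ^ 2) := by
  have hA : 0 < σ - b / 4 := by linarith
  have hσ : 0 < σ := by linarith
  refine ⟨_, (((hP.pow 2).div_const 2).add ((hP.const_mul (σ - b / 4)).mul (hX.sub hN))).add
    (hasDerivAt_yangPotential hb.ne' hX hN hN0.ne' (by positivity)), ?_⟩
  refine le_trans (le_of_eq ?_) (b := -(b / 4) * P t ^ 2 + (σ - b / 4) * b * (X t - N t) *
      (X t * (7 * N t + 8 * X t) / (3 * (N t + 2 * X t) ^ 2)) * P t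
     - (X t - N t) ^ 2 * ((σ - b / 4) * ((b * (σ + b) - σ * r) / 2 + b * X t / N t * (σ / 2 +
       b * (4 * X t ^ 4 + 12 * X t ^ 3 * N t + 47 * X t ^ 2 * N t ^ 2 + 42 * X t * N t ^ 3 +
         9 * N t ^ 4) / (12 * N t ^ 2 * (N t + 2 * X t) ^ 2))) +
       N t ^ 2 / (2 * b) *
         ((σ - b / 4 - b * (X t + N t) / (2 * N t)) ^ 2 + (σ - b / 4) * b / 4))) ?_
  · rw [← yang_dissipation_identity hb.ne' hN0.ne' (by positivity)]
    simp only [Pi.sub_apply]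
    push_cast
    ring
  · generalize X t = X at *
    generalize N t = N at *
    generalize P t = P
    set A := σ - b / 4 with hAdef
    have hJ := yang_quartic_pos hX0.le hN0.le
    set J := X * (7 * N + 8 * X) / (3 * (N + 2 * X) ^ 2) with hJdef
    have hJ2 : 25 / 12 * J ^ 2 ≤ X / N := by
      rw [hJdef, div_pow, le_div_iff₀ hN0, mul_div_assoc', div_mul_eq_mul_div,
        div_le_iff₀ (by positivity)]
      nlinarith [mul_le_mul_of_nonneg_left hJ hX0.le]
    have hG : 25 / 24 * (A ^ 2 * b * J ^ 2) ≤
        A * ((b * (σ + b) - σ * r) / 2 + b * X / N * (σ / 2 +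
          b * (4 * X ^ 4 + 12 * X ^ 3 * N + 47 * X ^ 2 * N ^ 2 + 42 * X * N ^ 3 + 9 * N ^ 4) /
          (12 * N ^ 2 * (N + 2 * X) ^ 2))) +
        N ^ 2 / (2 * b) * ((A - b * (X + N) / (2 * N)) ^ 2 + A * b / 4) := by
      have e1 : 25 / 24 * (A ^ 2 * b * J ^ 2) ≤ A * (b * X / N * (σ / 2)) := by
        have hAσ : A * b * (A * (25 / 12 * J ^ 2)) ≤ A * b * (σ * (X / N)) :=
          mul_le_mul_of_nonneg_left
            (mul_le_mul (by rw [hAdef]; linarith) hJ2 (by positivity) hσ.le) (by positivity)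
        have e : A * (b * X / N * (σ / 2)) = A * b * (σ * (X / N)) / 2 := by ring
        rw [e]
        linarith
      have e2 : 0 ≤ A * ((b * (σ + b) - σ * r) / 2) :=
        mul_nonneg hA.le (by linarith)
      have e3 : 0 ≤ A * (b * X / N * (b * (4 * X ^ 4 + 12 * X ^ 3 * N + 47 * X ^ 2 * N ^ 2 +
          42 * X * N ^ 3 + 9 * N ^ 4) / (12 * N ^ 2 * (N + 2 * X) ^ 2))) := by positivity
      have e4 : 0 ≤ N ^ 2 / (2 * b) * ((A - b * (X + N) / (2 * N)) ^ 2 + A * b / 4) := by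
        positivity
      linarith
    have h1 := mul_le_mul_of_nonneg_left hG (sq_nonneg (X - N))
    have h2 : 0 ≤ 6 * b / 25 * (P - 25 / 12 * (A * (X - N) * J)) ^ 2 := by positivity
    linarith

theorem exists_le_yangPotential (σ b r M : ℝ) (hb : 0 < b) (hbσ : b < 2 * σ) (hr : 0 < r) :
    ∃ C, ∀ X N, 0 ≤ X → X ≤ M → 0 < N → N ≤ M → C ≤ yangPotential σ b r X N := by
  have hA : 0 < σ - b / 4 := by linarith
  have hB : 0 < σ - b / 2 := by linarith
  have hσ : 0 < σ := by linarith
  refine ⟨-(σ * r * M ^ 2 / 2 + (σ - b / 4) * b / 6 * (3 * (M * M)) +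
    σ * (σ - b / 4) / b * (r * M ^ 2 / 2) + (σ - b / 2) * M ^ 4 / (4 * b)),
    fun X N hX hXM hN hNM => ?_⟩
  unfold yangPotential
  have h1 : σ * r * X ^ 2 / 2 ≤ σ * r * M ^ 2 / 2 := by gcongr
  have h2 : 0 ≤ (σ - b / 2) * N ^ 2 * X ^ 2 / (2 * b) := by positivity
  have h3 : 0 ≤ σ * (σ - b / 4) * (X - N) ^ 2 / 2 := by positivity
  have h4 : (σ - b / 4) * b / 6 * (3 * (N * X)) ≤ (σ - b / 4) * b / 6 * (3 * (M * M)) := by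
    gcongr
    exact hN.le.trans hNM
  have h5 : 0 ≤ (σ - b / 4) * b / 6 * (X ^ 3 / N + 2 * N ^ 2) := by positivity
  have h6 : 0 ≤ (σ - b / 4) * b / 6 * ((X - N) ^ 2 * (N + 4 * X) / (N + 2 * X)) := by positivity
  have h7 : σ * (σ - b / 4) / b * (r * N ^ 2 / 2) ≤ σ * (σ - b / 4) / b * (r * M ^ 2 / 2) := by
    gcongr
  have h8 : 0 ≤ σ * (σ - b / 4) / b * (N ^ 4 / (4 * b)) := by positivity
  have h9 : (σ - b / 2) * N ^ 4 / (4 * b) ≤ (σ - b / 2) * M ^ 4 / (4 * b) := by gcongr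
  have h10 : 0 ≤ X ^ 4 / 8 := by positivity
  linarith

/-- The extension of `yangLyapunov` by the symmetry `(X, P) ↦ (-X, -P)`; it is discontinuous
across `X = 0`. -/
noncomputable def yangSignedLyapunov (σ b r X P N : ℝ) : ℝ :=
  P ^ 2 / 2 + (σ - b / 4) * (SignType.sign X * P) * (|X| - N) + yangPotential σ b r |X| N

theorem yangSignedLyapunov_eq {σ b r X P N e : ℝ} (he : e = 1 ∨ e = -1) (hX : 0 < e * X) :
    yangSignedLyapunov σ b r X P N = yangLyapunov σ b r (e * X) (e * P) N := by
  unfold yangSignedLyapunov yangLyapunov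
  rcases he with rfl | rfl
  · rw [one_mul] at hX
    simp [abs_of_pos hX, sign_pos hX]
  · have hX' : X < 0 := by linarith
    simp [abs_of_neg hX', sign_neg hX']

theorem le_yangSignedLyapunov {σ b r X P N C : ℝ} (hA : 0 ≤ σ - b / 4) (hN : 0 ≤ N)
    (hC : C ≤ yangPotential σ b r |X| N) :
    C + -((σ - b / 4) * (|P| * (|X| + N))) ≤ yangSignedLyapunov σ b r X P N := by
  unfold yangSignedLyapunov
  have h1 : |(SignType.sign X : ℝ) * P * (|X| - N)| ≤ |P| * (|X| + N) := by
    rw [abs_mul, abs_mul]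
    have hs : |(SignType.sign X : ℝ)| ≤ 1 := by
      rcases lt_trichotomy X 0 with h | h | h <;> simp [h]
    have hXN : |(|X| - N)| ≤ |X| + N := abs_le.2 ⟨by linarith [abs_nonneg X], by linarith⟩
    exact mul_le_mul (mul_le_of_le_one_left (abs_nonneg _) hs) hXN (abs_nonneg _) (abs_nonneg _)
  have h2 := mul_le_mul_of_nonneg_left (abs_le.1 h1).1 hA
  have h3 := sq_nonneg P
  linarith

theorem antitoneOn_yangSignedLyapunov {σ b r T : ℝ} {X P N E : ℝ → ℝ} (hb : 0 < b)
    (hbσ : b < 2 * σ) (hr : r * σ < b * (σ + b)) (hX : ∀ t, T ≤ t → HasDerivAt X (P t) t)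
    (hP : ∀ t, T ≤ t → HasDerivAt P
      (-σ * P t + X t * (σ * r - (X t ^ 2 + (2 * σ - b) / b * N t ^ 2) / 2)) t)
    (hN : ∀ t, T ≤ t → HasDerivAt N (b * (X t ^ 2 - N t ^ 2) / (2 * N t)) t)
    (hE : ∀ t, T ≤ t → HasDerivAt E (P t ^ 2) t) (hN0 : ∀ t, T ≤ t → 0 < N t)
    (hXP : ∀ t, T ≤ t → X t = 0 → P t ≠ 0) :
    AntitoneOn (fun t => yangSignedLyapunov σ b r (X t) (P t) (N t) + b / 100 * E t) (Ici T) := by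
  have hA : 0 < σ - b / 4 := by linarith
  refine antitoneOn_Ici_of_hasDerivAt_or_jump fun t ht => ?_
  rcases eq_or_ne (X t) 0 with h0 | h0
  · right
    have hlim : ∀ {e : ℝ} {l : Filter ℝ}, l ≤ 𝓝 t → (e = 1 ∨ e = -1) →
        (∀ᶠ s in l, 0 < e * X s) →
        Tendsto (fun t => yangSignedLyapunov σ b r (X t) (P t) (N t) + b / 100 * E t) l
          (𝓝 (yangLyapunov σ b r (e * X t) (e * P t) (N t) + b / 100 * E t)) := by
      intro e l hl he hpos
      have hXe := (hX t ht).const_mul e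
      have hW : ContinuousAt (fun s => yangLyapunov σ b r (e * X s) (e * P s) (N s) +
          b / 100 * E s) t :=
        ((((((hP t ht).const_mul e).pow 2).div_const 2).add
          ((((hP t ht).const_mul e).const_mul (σ - b / 4)).mul (hXe.sub (hN t ht)))).add
          (hasDerivAt_yangPotential hb.ne' hXe (hN t ht) (hN0 t ht).ne'
            (by simpa [h0] using (hN0 t ht).ne'))).continuousAt.add
          ((hE t ht).const_mul (b / 100)).continuousAt
      refine (hW.tendsto.mono_left hl).congr' ?_
      filter_upwards [hpos] with s hs
      rw [yangSignedLyapunov_eq he hs]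
    have hslope := hasDerivAt_iff_tendsto_slope.1 (hX t ht)
    have main : ∀ e : ℝ, (e = 1 ∨ e = -1) → 0 < e * P t →
        (∀ᶠ s in 𝓝[>] t, 0 < e * X s) ∧ ∀ᶠ s in 𝓝[<] t, 0 < -e * X s := by
      intro e he hpos
      have hev := (hslope.const_mul e).eventually (lt_mem_nhds hpos)
      constructor
      · filter_upwards [hev.filter_mono (nhdsWithin_mono t fun s (hs : t < s) => hs.ne'),
          self_mem_nhdsWithin] with s hs hts
        have hts' : 0 < s - t := sub_pos.2 hts
        rw [slope_def_field, h0, sub_zero, mul_div_assoc'] at hs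
        exact (div_pos_iff_of_pos_right hts').1 hs
      · filter_upwards [hev.filter_mono (nhdsWithin_mono t fun s (hs : s < t) => hs.ne),
          self_mem_nhdsWithin] with s hs hts
        have hts' : s - t < 0 := sub_neg.2 hts
        rw [slope_def_field, h0, sub_zero, mul_div_assoc'] at hs
        rcases div_pos_iff.1 hs with h | h <;> linarith
    obtain ⟨e, he, hpos⟩ : ∃ e : ℝ, (e = 1 ∨ e = -1) ∧ 0 < e * P t := by
      rcases (hXP t ht h0).lt_or_gt with h | h
      · exact ⟨-1, .inr rfl, by linarith⟩
      · exact ⟨1, .inl rfl, by linarith⟩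
    have he2 : e ^ 2 = 1 := by rcases he with rfl | rfl <;> norm_num
    have he' : -e = 1 ∨ -e = -1 := by rcases he with rfl | rfl <;> simp
    have hjump : 0 < (σ - b / 4) * (e * P t) * N t := by
      have := hN0 t ht
      positivity
    refine ⟨⟨_, ?_, hlim nhdsWithin_le_nhds he (main e he hpos).1⟩,
      ⟨_, ?_, hlim nhdsWithin_le_nhds he' (main e he hpos).2⟩⟩
    · simp only [yangLyapunov, yangSignedLyapunov, h0, mul_pow, he2, mul_zero, abs_zero, sign_zero,
        SignType.coe_zero]
      linarith
    · simp only [yangLyapunov, yangSignedLyapunov, h0, mul_pow, neg_sq, he2, mul_zero, abs_zero,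
        sign_zero, SignType.coe_zero]
      linarith
  · left
    obtain ⟨e, he, hpos⟩ : ∃ e : ℝ, (e = 1 ∨ e = -1) ∧ 0 < e * X t := by
      rcases h0.lt_or_gt with h | h
      · exact ⟨-1, .inr rfl, by linarith⟩
      · exact ⟨1, .inl rfl, by linarith⟩
    have he2 : e ^ 2 = 1 := by rcases he with rfl | rfl <;> norm_num
    obtain ⟨V', hV, hV'⟩ := yangLyapunov_dissipation hb hbσ hr ((hX t ht).const_mul e)
      (((hP t ht).const_mul e).congr_deriv (by rw [mul_pow, he2]; ring))
      ((hN t ht).congr_deriv (by rw [mul_pow, he2, one_mul])) hpos (hN0 t ht)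
    refine ⟨V' + b / 100 * P t ^ 2, (hV.congr_of_eventuallyEq ?_).add
      ((hE t ht).const_mul (b / 100)), ?_⟩
    · filter_upwards [((hX t ht).const_mul e).continuousAt.eventually (lt_mem_nhds hpos)] with s hs
      exact yangSignedLyapunov_eq he hs
    · rw [mul_pow, he2, one_mul] at hV'
      linarith

/-- A forward solution of the Yang system that is bounded on `[0, ∞)`. -/
structure IsBoundedYangSolution (σ b r : ℝ) (x y z : ℝ → ℝ) : Prop where
  hasDerivAt_x : ∀ t, 0 ≤ t → HasDerivAt x (σ * (y t - x t)) t
  hasDerivAt_y : ∀ t, 0 ≤ t → HasDerivAt y (r * x t - x t * z t) t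
  hasDerivAt_z : ∀ t, 0 ≤ t → HasDerivAt z (-b * z t + x t * y t) t
  isBounded : Bornology.IsBounded ((fun t => (x t, y t, z t)) '' Ici (0 : ℝ))

namespace IsBoundedYangSolution

variable {σ b r : ℝ} {x y z : ℝ → ℝ}

theorem exists_bound (h : IsBoundedYangSolution σ b r x y z) {f : ℝ × ℝ × ℝ → ℝ}
    (hf : Continuous f) : ∃ K, ∀ t, 0 ≤ t → |f (x t, y t, z t)| ≤ K := by
  obtain ⟨K, hK⟩ := h.isBounded.isCompact_closure.exists_bound_of_continuousOn hf.continuousOn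
  exact ⟨K, fun t ht => hK _ (subset_closure ⟨t, ht, rfl⟩)⟩

theorem hasDerivAt_velocity (h : IsBoundedYangSolution σ b r x y z) {t : ℝ} (ht : 0 ≤ t) :
    HasDerivAt (fun s => σ * (y s - x s)) (σ * (r * x t - x t * z t - σ * (y t - x t))) t :=
  ((h.hasDerivAt_y t ht).sub (h.hasDerivAt_x t ht)).const_mul σ

/-- If the velocity of the first coordinate vanishes asymptotically, the solution converges. -/
theorem exists_tendsto (h : IsBoundedYangSolution σ b r x y z) (hσ : 0 < σ) (hb : 0 < b)
    (hr : 0 < r) (hp : Tendsto (fun t => σ * (y t - x t)) atTop (𝓝 0)) :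
    ∃ p : ℝ × ℝ × ℝ,
      (σ * (p.2.1 - p.1) = 0 ∧ r * p.1 - p.1 * p.2.2 = 0 ∧ -b * p.2.2 + p.1 * p.2.1 = 0) ∧
      Tendsto (fun t => (x t, y t, z t)) atTop (𝓝 p) := by
  have hxb : ∃ K, ∀ t, 0 ≤ t → |x t| ≤ K := h.exists_bound (f := fun q => q.1) (by fun_prop)
  obtain ⟨K, hK⟩ := hxb
  have hxmul : ∀ {g : ℝ → ℝ}, Tendsto g atTop (𝓝 0) →
      Tendsto (fun t => x t * g t) atTop (𝓝 0) := fun {g} hg => by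
    rw [tendsto_zero_iff_abs_tendsto_zero]
    refine squeeze_zero' (.of_forall fun _ => abs_nonneg _)
      (eventually_atTop.2 ⟨0, fun t ht => ?_⟩)
      (by simpa using (hg.abs.const_mul K : Tendsto _ _ _))
    simp only [Function.comp_apply, abs_mul]
    exact mul_le_mul_of_nonneg_right (hK t ht) (abs_nonneg _)
  have hq : Tendsto (fun t => y t - x t) atTop (𝓝 0) := by
    have := hp.const_mul σ⁻¹
    simpa [hσ.ne'] using this
  have hd : Tendsto (fun t => b * z t - x t ^ 2) atTop (𝓝 0) := by
    refine tendsto_zero_of_hasDerivAt_decay (T := 0) hb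
      (g := fun t => (b - 2 * σ) * (x t * (y t - x t))) (fun t ht => ?_)
      (by simpa using (hxmul hq).const_mul (b - 2 * σ))
    refine (((h.hasDerivAt_z t ht).const_mul b).sub
      ((h.hasDerivAt_x t ht).pow 2)).congr_deriv ?_
    norm_num
    ring
  have hp1 : Tendsto (fun t => σ * (r * x t - x t * z t - σ * (y t - x t))) atTop (𝓝 0) := by
    obtain ⟨K₂, hK₂⟩ := h.exists_bound (f := fun q => σ * (r * (σ * (q.2.1 - q.1)) -
      (σ * (q.2.1 - q.1) * q.2.2 + q.1 * (-b * q.2.2 + q.1 * q.2.1)) -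
      σ * (r * q.1 - q.1 * q.2.2 - σ * (q.2.1 - q.1)))) (by fun_prop)
    refine tendsto_zero_of_tendsto_of_hasDerivAt (fun t ht => h.hasDerivAt_velocity ht)
      (fun t ht => ?_) hK₂ hp
    have hx := h.hasDerivAt_x t ht
    exact (((hx.const_mul r).sub (hx.mul (h.hasDerivAt_z t ht))).sub
      (h.hasDerivAt_velocity ht)).const_mul σ
  have hs : 0 < √(b * r) := Real.sqrt_pos.2 (mul_pos hb hr)
  have hs2 : √(b * r) ^ 2 = b * r := Real.sq_sqrt (mul_pos hb hr).le
  obtain ⟨l, hl, hxl⟩ := exists_tendsto_of_tendsto_cubic (f := x) (T := 0) hs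
    (fun t ht => (h.hasDerivAt_x t ht).continuousAt.continuousWithinAt) (by
      have := ((hp1.const_mul (b / σ)).add (hp.const_mul b)).add (hxmul hd)
      simp only [mul_zero, add_zero] at this
      refine this.congr fun t => ?_
      rw [hs2]
      field_simp
      ring)
  rw [hs2] at hl
  have hyl : Tendsto y atTop (𝓝 l) := by simpa using hq.add hxl
  have hzl : Tendsto z atTop (𝓝 (l ^ 2 / b)) := by
    have := (hd.add (hxl.pow 2)).div_const b
    simpa [hb.ne'] using this
  refine ⟨(l, l, l ^ 2 / b), ⟨by simp, ?_, ?_⟩, hxl.prodMk_nhds (hyl.prodMk_nhds hzl)⟩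
  · field_simp
    linarith
  · field_simp
    ring

theorem exists_tendsto_of_lyapunov (h : IsBoundedYangSolution σ b r x y z) (hσ : 0 < σ)
    (hb : 0 < b) (hr : 0 < r) {V : ℝ → ℝ} {T κ C : ℝ} (hT : 0 ≤ T) (hκ : 0 < κ)
    (hV : ∀ E : ℝ → ℝ, (∀ t, T ≤ t → HasDerivAt E ((σ * (y t - x t)) ^ 2) t) →
      AntitoneOn (fun t => V t + κ * E t) (Ici T))
    (hC : ∀ t, T ≤ t → C ≤ V t) :
    ∃ p : ℝ × ℝ × ℝ,
      (σ * (p.2.1 - p.1) = 0 ∧ r * p.1 - p.1 * p.2.2 = 0 ∧ -b * p.2.2 + p.1 * p.2.1 = 0) ∧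
      Tendsto (fun t => (x t, y t, z t)) atTop (𝓝 p) := by
  refine h.exists_tendsto hσ hb hr ?_
  obtain ⟨E, hE⟩ := exists_primitive_on_Ici (f := fun t => (σ * (y t - x t)) ^ 2) fun t ht =>
    ((h.hasDerivAt_velocity ht).pow 2).continuousAt
  obtain ⟨K, hK⟩ := h.exists_bound (f := fun q => σ * (q.2.1 - q.1)) (by fun_prop)
  obtain ⟨K₁, hK₁⟩ := h.exists_bound
    (f := fun q => σ * (r * q.1 - q.1 * q.2.2 - σ * (q.2.1 - q.1))) (by fun_prop)
  exact tendsto_zero_of_antitoneOn_add_energy hκ (fun t ht => hE t (hT.trans ht))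
    (fun t ht => h.hasDerivAt_velocity (hT.trans ht))
    (fun t ht => (hK t (hT.trans ht)).trans (le_max_left K K₁))
    (fun t ht => (hK₁ t (hT.trans ht)).trans (le_max_right K K₁))
    (hV E fun t ht => hE t (hT.trans ht)) hC

theorem hasDerivAt_excess (h : IsBoundedYangSolution σ b r x y z) (hσ : 0 < σ) {t : ℝ}
    (ht : 0 ≤ t) : HasDerivAt (fun s => z s - x s ^ 2 / (2 * σ))
      ((2 * σ - b) / (2 * σ) * x t ^ 2 - b * (z t - x t ^ 2 / (2 * σ))) t := by
  refine ((h.hasDerivAt_z t ht).sub (((h.hasDerivAt_x t ht).pow 2).div_const (2 * σ))).congr_deriv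
    ?_
  norm_num
  field_simp
  ring

theorem hasDerivAt_energy (h : IsBoundedYangSolution σ b r x y z) (hσ : 0 < σ) {t : ℝ}
    (ht : 0 ≤ t) :
    HasDerivAt (fun s => (σ * (y s - x s)) ^ 2 / 2 + x s ^ 4 / 8 - σ * r * x s ^ 2 / 2)
      (-σ * (σ * (y t - x t)) ^ 2 -
        σ * x t * (σ * (y t - x t)) * (z t - x t ^ 2 / (2 * σ))) t := by
  have hx := h.hasDerivAt_x t ht
  refine (((((h.hasDerivAt_velocity ht).pow 2).div_const 2).add ((hx.pow 4).div_const 8)).sub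
    (((hx.pow 2).const_mul (σ * r)).div_const 2)).congr_deriv ?_
  norm_num
  field_simp
  ring

theorem exists_tendsto_of_eq (h : IsBoundedYangSolution σ b r x y z) (hσ : 0 < σ)
    (hb : 0 < b) (hr : 0 < r) (hbσ : b = 2 * σ) :
    ∃ p : ℝ × ℝ × ℝ,
      (σ * (p.2.1 - p.1) = 0 ∧ r * p.1 - p.1 * p.2.2 = 0 ∧ -b * p.2.2 + p.1 * p.2.1 = 0) ∧
      Tendsto (fun t => (x t, y t, z t)) atTop (𝓝 p) := by
  obtain ⟨M, hM⟩ := h.exists_bound (f := fun q => q.1 ^ 2) (by fun_prop)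
  obtain ⟨C, hC⟩ := h.exists_bound (f := fun q => (σ * (q.2.1 - q.1)) ^ 2 / 2 + q.1 ^ 4 / 8 -
    σ * r * q.1 ^ 2 / 2 + σ * M / (4 * b) * (q.2.2 - q.1 ^ 2 / (2 * σ)) ^ 2) (by fun_prop)
  refine h.exists_tendsto_of_lyapunov hσ hb hr (κ := σ / 2) le_rfl (by positivity)
    (fun E hE => ?_) (fun t ht => (abs_le.1 (hC t ht)).1)
  refine antitoneOn_Ici_of_hasDerivAt (fun t ht => ((h.hasDerivAt_energy hσ ht).add
    (((h.hasDerivAt_excess hσ ht).pow 2).const_mul (σ * M / (4 * b)))).add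
      ((hE t ht).const_mul (σ / 2))) fun t ht => ?_
  have hMt := (abs_le.1 (hM t ht)).2
  generalize z t - x t ^ 2 / (2 * σ) = u
  generalize σ * (y t - x t) = p
  simp only at hMt
  have e : σ * M / (4 * b) * ((2 : ℕ) * u ^ (2 - 1) * ((2 * σ - b) / (2 * σ) * x t ^ 2 - b * u)) =
      -(σ / 2 * (M * u ^ 2)) := by
    rw [← hbσ]
    norm_num
    field_simp
    ring
  rw [e]
  have h1 : σ / 2 * (x t ^ 2 * u ^ 2) ≤ σ / 2 * (M * u ^ 2) := by gcongr
  have h2 : 0 ≤ σ / 2 * (p + x t * u) ^ 2 := by positivity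
  linarith

theorem exists_tendsto_of_gt (h : IsBoundedYangSolution σ b r x y z) (hσ : 0 < σ)
    (hb : 0 < b) (hr : 0 < r) (hbσ : 2 * σ < b) :
    ∃ p : ℝ × ℝ × ℝ,
      (σ * (p.2.1 - p.1) = 0 ∧ r * p.1 - p.1 * p.2.2 = 0 ∧ -b * p.2.2 + p.1 * p.2.1 = 0) ∧
      Tendsto (fun t => (x t, y t, z t)) atTop (𝓝 p) := by
  obtain ⟨C, hC⟩ := h.exists_bound (f := fun q => (σ * (q.2.1 - q.1)) ^ 2 / 2 + q.1 ^ 4 / 8 -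
    σ * r * q.1 ^ 2 / 2 + σ / 2 * ((q.2.2 - q.1 ^ 2 / (2 * σ)) * q.1 ^ 2) +
      σ ^ 2 * b / (2 * (b - 2 * σ)) * (q.2.2 - q.1 ^ 2 / (2 * σ)) ^ 2) (by fun_prop)
  refine h.exists_tendsto_of_lyapunov hσ hb hr le_rfl hσ
    (fun E hE => ?_) (fun t ht => (abs_le.1 (hC t ht)).1)
  refine antitoneOn_Ici_of_hasDerivAt (fun t ht => (((h.hasDerivAt_energy hσ ht).add
    (((h.hasDerivAt_excess hσ ht).mul ((h.hasDerivAt_x t ht).pow 2)).const_mul (σ / 2))).add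
    (((h.hasDerivAt_excess hσ ht).pow 2).const_mul (σ ^ 2 * b / (2 * (b - 2 * σ))))).add
      ((hE t ht).const_mul σ)) fun t ht => ?_
  simp only [Pi.pow_apply]
  have hbσ' : 0 < b - 2 * σ := by linarith
  generalize z t - x t ^ 2 / (2 * σ) = u
  generalize σ * (y t - x t) = p
  have h2 : 0 ≤ σ ^ 2 / (b - 2 * σ) * ((2 * σ - b) / (2 * σ) * x t ^ 2 - b * u) ^ 2 := by
    positivity
  refine le_trans (le_of_eq ?_) (neg_nonpos.2 h2)
  obtain ⟨δ, rfl⟩ : ∃ δ, b = 2 * σ + δ := ⟨b - 2 * σ, by ring⟩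
  have hδ : 0 < δ := by linarith
  rw [add_sub_cancel_left]
  norm_num
  field_simp
  ring

theorem exists_tendsto_of_excess_nonpos (h : IsBoundedYangSolution σ b r x y z) (hσ : 0 < σ)
    (hb : 0 < b) (hr : 0 < r) (hbσ : b < 2 * σ) (hu : ∀ t, 0 ≤ t → z t - x t ^ 2 / (2 * σ) ≤ 0) :
    ∃ p : ℝ × ℝ × ℝ,
      (σ * (p.2.1 - p.1) = 0 ∧ r * p.1 - p.1 * p.2.2 = 0 ∧ -b * p.2.2 + p.1 * p.2.1 = 0) ∧
      Tendsto (fun t => (x t, y t, z t)) atTop (𝓝 p) := by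
  have hc : 0 < (2 * σ - b) / (2 * σ) := div_pos (by linarith) (by linarith)
  have hanti : AntitoneOn (fun t => -(z t - x t ^ 2 / (2 * σ))) (Ici 0) :=
    antitoneOn_Ici_of_hasDerivAt (fun t ht => (h.hasDerivAt_excess hσ ht).fun_neg) fun t ht => by
      have h1 := mul_nonneg hc.le (sq_nonneg (x t))
      have h2 := mul_nonpos_of_nonneg_of_nonpos hb.le (hu t ht)
      linarith
  obtain ⟨l, hl⟩ := hanti.exists_tendsto_of_le (C := 0) fun t ht => neg_nonneg.2 (hu t ht)
  obtain ⟨K, hK⟩ := h.exists_bound (f := fun q => -((2 * σ - b) / (2 * σ) *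
    (2 * q.1 * (σ * (q.2.1 - q.1))) - b * ((2 * σ - b) / (2 * σ) * q.1 ^ 2 -
      b * (q.2.2 - q.1 ^ 2 / (2 * σ))))) (by fun_prop)
  have hu' := (tendsto_zero_of_tendsto_of_hasDerivAt
    (fun t ht => (h.hasDerivAt_excess hσ ht).fun_neg)
    (fun t ht => (((((h.hasDerivAt_x t ht).pow 2).const_mul ((2 * σ - b) / (2 * σ))).sub
      ((h.hasDerivAt_excess hσ ht).const_mul b)).fun_neg).congr_deriv (by norm_num)) hK hl).neg
  have hu'' : Tendsto (fun t => ((2 * σ - b) / (2 * σ) * x t ^ 2 -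
      b * (z t - x t ^ 2 / (2 * σ))) / ((2 * σ - b) / (2 * σ))) atTop (𝓝 0) := by
    simpa using hu'.div_const ((2 * σ - b) / (2 * σ))
  have hx2 : Tendsto (fun t => x t ^ 2) atTop (𝓝 0) := by
    refine squeeze_zero' (.of_forall fun _ => sq_nonneg _)
      (eventually_atTop.2 ⟨0, fun t ht => ?_⟩) hu''
    rw [le_div_iff₀ hc]
    have := mul_nonpos_of_nonneg_of_nonpos hb.le (hu t ht)
    linarith
  have hx : Tendsto x atTop (𝓝 0) := by
    have := hx2.sqrt
    simp only [Real.sqrt_sq_eq_abs, Real.sqrt_zero] at this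
    exact (tendsto_zero_iff_abs_tendsto_zero _).2 this
  obtain ⟨K₁, hK₁⟩ := h.exists_bound
    (f := fun q => σ * (r * q.1 - q.1 * q.2.2 - σ * (q.2.1 - q.1))) (by fun_prop)
  exact h.exists_tendsto hσ hb hr (tendsto_zero_of_tendsto_of_hasDerivAt h.hasDerivAt_x
    (fun t ht => h.hasDerivAt_velocity ht) hK₁ hx)

theorem excess_pos (h : IsBoundedYangSolution σ b r x y z) (hσ : 0 < σ) (hbσ : b < 2 * σ)
    {T : ℝ} (hT : 0 ≤ T) (hu : 0 < z T - x T ^ 2 / (2 * σ)) {t : ℝ} (ht : T ≤ t) :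
    0 < z t - x t ^ 2 / (2 * σ) := by
  have hc : 0 < (2 * σ - b) / (2 * σ) := div_pos (by linarith) (by linarith)
  have hanti : AntitoneOn (fun t => -((z t - x t ^ 2 / (2 * σ)) * Real.exp (b * t))) (Ici T) := by
    refine antitoneOn_Ici_of_hasDerivAt
      (f' := fun t => -((2 * σ - b) / (2 * σ) * x t ^ 2 * Real.exp (b * t)))
      (fun s hs => ?_) (fun s _ => neg_nonpos.2 (by positivity))
    refine (((h.hasDerivAt_excess hσ (hT.trans hs)).mul
      ((hasDerivAt_id s).const_mul b).exp).fun_neg).congr_deriv ?_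
    simp only [id]
    ring
  have h1 := neg_le_neg_iff.1 (hanti (mem_Ici.2 le_rfl) ht ht)
  exact pos_of_mul_pos_left ((mul_pos hu (Real.exp_pos _)).trans_le h1) (Real.exp_pos _).le

theorem exists_tendsto_of_rest (h : IsBoundedYangSolution σ b r x y z) (hσ : 0 < σ)
    (hb : 0 < b) (hr : 0 < r) {T : ℝ} (hT : 0 ≤ T) (hxT : x T = 0) (hpT : σ * (y T - x T) = 0) :
    ∃ p : ℝ × ℝ × ℝ,
      (σ * (p.2.1 - p.1) = 0 ∧ r * p.1 - p.1 * p.2.2 = 0 ∧ -b * p.2.2 + p.1 * p.2.1 = 0) ∧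
      Tendsto (fun t => (x t, y t, z t)) atTop (𝓝 p) := by
  obtain ⟨K, hK⟩ := h.exists_bound (f := fun q => 1 + σ * (r - q.2.2)) (by fun_prop)
  have hanti : AntitoneOn
      (fun t => (x t ^ 2 + (σ * (y t - x t)) ^ 2) * Real.exp (-K * t)) (Ici T) := by
    refine antitoneOn_Ici_of_hasDerivAt (fun t ht =>
      (((h.hasDerivAt_x t (hT.trans ht)).pow 2).add
        ((h.hasDerivAt_velocity (hT.trans ht)).pow 2)).mul
        ((hasDerivAt_id t).const_mul (-K)).exp) fun t ht => ?_
    have hKt := hK t (hT.trans ht)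
    simp only [Pi.add_apply, Pi.pow_apply, id]
    have e : σ * (r * x t - x t * z t - σ * (y t - x t)) =
      x t * (1 + σ * (r - z t)) - x t - σ * (σ * (y t - x t)) := by ring
    rw [e]
    generalize 1 + σ * (r - z t) = k at *
    generalize σ * (y t - x t) = p
    have h1 : 2 * (x t * p) * k ≤ K * (x t ^ 2 + p ^ 2) := by
      calc 2 * (x t * p) * k ≤ |2 * (x t * p) * k| := le_abs_self _
        _ = |2 * x t * p| * |k| := by rw [abs_mul, mul_assoc]
        _ ≤ (x t ^ 2 + p ^ 2) * K :=
          mul_le_mul (abs_le.2 ⟨by nlinarith [sq_nonneg (x t + p)], two_mul_le_add_sq _ _⟩)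
            hKt (abs_nonneg _) (by positivity)
        _ = _ := mul_comm _ _
    have h2 : 0 ≤ σ * p ^ 2 := by positivity
    have h3 : (2 * x t * p + 2 * p * (x t * k - x t - σ * p) - K * (x t ^ 2 + p ^ 2)) *
        Real.exp (-K * t) ≤ 0 :=
      mul_nonpos_of_nonpos_of_nonneg (by linarith) (Real.exp_pos _).le
    refine le_trans (le_of_eq ?_) h3
    norm_num
    ring
  refine h.exists_tendsto hσ hb hr (tendsto_const_nhds.congr' ?_)
  filter_upwards [eventually_ge_atTop T] with t ht
  have h1 := hanti (mem_Ici.2 le_rfl) ht ht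
  beta_reduce at h1
  rw [hpT, hxT] at h1
  norm_num only [zero_mul] at h1
  have h2 := nonpos_of_mul_nonpos_left h1 (Real.exp_pos _)
  have h3 : (σ * (y t - x t)) ^ 2 = 0 :=
    le_antisymm (by linarith [sq_nonneg (x t)]) (sq_nonneg _)
  exact (pow_eq_zero_iff two_ne_zero |>.1 h3).symm

theorem hasDerivAt_sqrt_excess (h : IsBoundedYangSolution σ b r x y z) (hσ : 0 < σ) (hb : 0 < b)
    (hbσ : b < 2 * σ) {t : ℝ} (ht : 0 ≤ t) (hu : 0 < z t - x t ^ 2 / (2 * σ)) :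
    HasDerivAt (fun s => √(2 * σ * b / (2 * σ - b) * (z s - x s ^ 2 / (2 * σ))))
      (b * (x t ^ 2 - √(2 * σ * b / (2 * σ - b) * (z t - x t ^ 2 / (2 * σ))) ^ 2) /
        (2 * √(2 * σ * b / (2 * σ - b) * (z t - x t ^ 2 / (2 * σ))))) t := by
  have hc : 0 < 2 * σ - b := by linarith
  have hpos : 0 < 2 * σ * b / (2 * σ - b) * (z t - x t ^ 2 / (2 * σ)) := by positivity
  refine (((h.hasDerivAt_excess hσ ht).const_mul _).sqrt hpos.ne').congr_deriv ?_
  rw [Real.sq_sqrt hpos.le]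
  congr 1
  field_simp

theorem exists_tendsto_of_lt (h : IsBoundedYangSolution σ b r x y z) (hσ : 0 < σ)
    (hb : 0 < b) (hr : 0 < r) (hbσ : b < 2 * σ) (hrσ : r * σ < b * (σ + b)) :
    ∃ p : ℝ × ℝ × ℝ,
      (σ * (p.2.1 - p.1) = 0 ∧ r * p.1 - p.1 * p.2.2 = 0 ∧ -b * p.2.2 + p.1 * p.2.1 = 0) ∧
      Tendsto (fun t => (x t, y t, z t)) atTop (𝓝 p) := by
  by_cases hu : ∀ t, 0 ≤ t → z t - x t ^ 2 / (2 * σ) ≤ 0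
  · exact h.exists_tendsto_of_excess_nonpos hσ hb hr hbσ hu
  by_cases hrest : ∃ t, 0 ≤ t ∧ x t = 0 ∧ σ * (y t - x t) = 0
  · obtain ⟨t, ht, hxt, hpt⟩ := hrest
    exact h.exists_tendsto_of_rest hσ hb hr ht hxt hpt
  push Not at hu hrest
  obtain ⟨T, hT, huT⟩ := hu
  have hA : 0 < σ - b / 4 := by linarith
  have hc : 0 < 2 * σ - b := by linarith
  obtain ⟨K, hK⟩ := h.exists_bound (f := fun q => q.1) (by fun_prop)
  obtain ⟨Kp, hKp⟩ := h.exists_bound (f := fun q => σ * (q.2.1 - q.1)) (by fun_prop)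
  obtain ⟨KN, hKN⟩ := h.exists_bound
    (f := fun q => √(2 * σ * b / (2 * σ - b) * (q.2.2 - q.1 ^ 2 / (2 * σ)))) (by fun_prop)
  have hN : ∀ t, T ≤ t → HasDerivAt _ _ t := fun t ht =>
    h.hasDerivAt_sqrt_excess hσ hb hbσ (hT.trans ht) (h.excess_pos hσ hbσ hT huT ht)
  have hN0 : ∀ t, T ≤ t → 0 < √(2 * σ * b / (2 * σ - b) * (z t - x t ^ 2 / (2 * σ))) :=
    fun t ht => Real.sqrt_pos.2 (mul_pos (by positivity) (h.excess_pos hσ hbσ hT huT ht))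
  have hp : ∀ t, T ≤ t → HasDerivAt (fun s => σ * (y s - x s)) (-σ * (σ * (y t - x t)) + x t *
      (σ * r - (x t ^ 2 + (2 * σ - b) / b *
        √(2 * σ * b / (2 * σ - b) * (z t - x t ^ 2 / (2 * σ))) ^ 2) / 2)) t := fun t ht => by
    refine (h.hasDerivAt_velocity (hT.trans ht)).congr_deriv ?_
    have e : (2 * σ - b) / b * (2 * σ * b / (2 * σ - b) * (z t - x t ^ 2 / (2 * σ))) =
        2 * σ * (z t - x t ^ 2 / (2 * σ)) := by
      have := hc.ne'
      field_simp
    rw [Real.sq_sqrt (Real.sqrt_pos.1 (hN0 t ht)).le, e]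
    field_simp
    ring
  have hx : ∀ t, T ≤ t → HasDerivAt x (σ * (y t - x t)) t := fun t ht =>
    h.hasDerivAt_x t (hT.trans ht)
  have hrest' : ∀ t, T ≤ t → x t = 0 → σ * (y t - x t) ≠ 0 := fun t ht =>
    hrest t (hT.trans ht)
  replace hK : ∀ t, T ≤ t → |x t| ≤ K := fun t ht => hK t (hT.trans ht)
  replace hKp : ∀ t, T ≤ t → |σ * (y t - x t)| ≤ Kp := fun t ht => hKp t (hT.trans ht)
  replace hKN : ∀ t, T ≤ t → |√(2 * σ * b / (2 * σ - b) * (z t - x t ^ 2 / (2 * σ)))| ≤ KN :=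
    fun t ht => hKN t (hT.trans ht)
  obtain ⟨C, hC⟩ := exists_le_yangPotential σ b r (max K KN) hb hbσ hr
  refine h.exists_tendsto_of_lyapunov hσ hb hr (T := T) (κ := b / 100)
    (V := fun t => yangSignedLyapunov σ b r (x t) (σ * (y t - x t))
      √(2 * σ * b / (2 * σ - b) * (z t - x t ^ 2 / (2 * σ))))
    (C := C + -((σ - b / 4) * (Kp * (K + KN)))) hT (by positivity) (fun E hE => ?_)
    (fun t ht => ?_)
  · exact antitoneOn_yangSignedLyapunov hb hbσ hrσ hx hp hN hE hN0 hrest'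
  · generalize hNt : √(2 * σ * b / (2 * σ - b) * (z t - x t ^ 2 / (2 * σ))) = N
    have hN0t := hN0 t ht
    have hKNt := hKN t ht
    rw [hNt] at hN0t hKNt
    rw [abs_of_pos hN0t] at hKNt
    have h1 := hC |x t| N (abs_nonneg _) ((hK t ht).trans (le_max_left _ _)) hN0t
      (hKNt.trans (le_max_right _ _))
    exact (add_le_add_right (neg_le_neg (mul_le_mul_of_nonneg_left
      (mul_le_mul (hKp t ht) (add_le_add (hK t ht) hKNt) (by positivity)
        ((abs_nonneg _).trans (hKp t ht))) hA.le)) C).trans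
      (le_yangSignedLyapunov hA.le hN0t.le h1)

end IsBoundedYangSolution

end YangSystem

/-- Yang system with r > 0: under the root condition on the associated quadratic and
b(b − σ) < rσ < b(σ + b), every solution bounded on [0, +∞) tends to an equilibrium. -/
theorem yang_r_pos_convergence
    (σ b r : ℝ) (hσ : 0 < σ) (hb : 0 < b) (hr : 0 < r)
    (γI γII : ℝ) (hroots : γI < γII)
    (hQI : 4 * b * r * σ ^ 2 * (γI + 2 * σ - b) ^ 2 +
      16 * σ * b * γI * (r * σ ^ 2 + b * (σ + b) ^ 2 - 4 * σ * (σ * r + σ * b - b ^ 2)) = 0)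
    (hQII : 4 * b * r * σ ^ 2 * (γII + 2 * σ - b) ^ 2 +
      16 * σ * b * γII * (r * σ ^ 2 + b * (σ + b) ^ 2 - 4 * σ * (σ * r + σ * b - b ^ 2)) = 0)
    (hγII : 0 < γII)
    (hlow : b * (b - σ) < r * σ) (hhigh : r * σ < b * (σ + b))
    (x y z : ℝ → ℝ)
    (hx : ∀ t : ℝ, 0 ≤ t → HasDerivAt x (σ * (y t - x t)) t)
    (hy : ∀ t : ℝ, 0 ≤ t → HasDerivAt y (r * x t - x t * z t) t)
    (hz : ∀ t : ℝ, 0 ≤ t → HasDerivAt z (-b * z t + x t * y t) t)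
    (hbdd : Bornology.IsBounded ((fun t => (x t, y t, z t)) '' Set.Ici (0 : ℝ))) :
    ∃ p : ℝ × ℝ × ℝ,
      (σ * (p.2.1 - p.1) = 0 ∧ r * p.1 - p.1 * p.2.2 = 0 ∧ -b * p.2.2 + p.1 * p.2.1 = 0) ∧
      Tendsto (fun t => (x t, y t, z t)) atTop (nhds p) := by
  have h : IsBoundedYangSolution σ b r x y z := ⟨hx, hy, hz, hbdd⟩
  rcases lt_trichotomy b (2 * σ) with hbσ | hbσ | hbσ
  · exact h.exists_tendsto_of_lt hσ hb hr hbσ hhigh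
  · exact h.exists_tendsto_of_eq hσ hb hr hbσ
  · exact h.exists_tendsto_of_gt hσ hb hr hbσ
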